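/- arXiv:2405.17087 — 2 statements merged into one kernel-verified Lean document; each statement's English description precedes it below -/
import Mathlib

section
/- Let ν > 0, q > 1, S_E > 0, S_V > 0. Let a = (a_k)_{k≥1} satisfy |a_n| ≤ S_E q^{−n} for all n ≥ 1, and let C = (C_k)_{k≥1} satisfy |C_n| ≤ S_V q^{−n} for all n ≥ 1. Then for every k ≥ 1 the series defining D̃F_k(a)C converges absolutely and D̃F_k(a)C ≤ k²(1 − ν k²) C_k + 2k S_E S_V q^{−3k} + 4k S_E S_V q^{−k} ((k−1) + (q² − 1)^{−1}). -/
/-- The variational vector field of the KS equation acting on a direction sequence `C`: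
`D̃F_k(a)C = (k²(1 - ν k²) + 2k a_{2k}) C_k
            + Σ_{i ≥ 1, i ≠ k} (2k ω(k,i) a_{|k-i|} + 2k a_{k+i}) C_i`,
where `ω(k,i) = -1` if `k > i` and `1` if `k < i`. -/
noncomputable def ksDF (ν : ℝ) (a C : ℕ → ℝ) (k : ℕ) : ℝ :=
  ((k : ℝ) ^ 2 * (1 - ν * (k : ℝ) ^ 2) + 2 * (k : ℝ) * a (2 * k)) * C k
    + ∑' i : ℕ,
        if 1 ≤ i ∧ i ≠ k then
          (2 * (k : ℝ) * (if i < k then (-1 : ℝ) else 1) * a (((k : ℤ) - (i : ℤ)).natAbs)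
              + 2 * (k : ℝ) * a (k + i)) * C i
        else 0

/-- Let `ν > 0`, `q > 1`, `S_E > 0`, `S_V > 0`.  Let `a` satisfy
`|a_n| ≤ S_E q^{-n}` and `C` satisfy `|C_n| ≤ S_V q^{-n}` for all `n ≥ 1`.  Then for every
`k ≥ 1` the series defining `D̃F_k(a)C` converges absolutely and
`D̃F_k(a)C ≤ k²(1 - ν k²) C_k + 2k S_E S_V q^{-3k} + 4k S_E S_V q^{-k} ((k-1) + (q² - 1)⁻¹)`. -/
theorem stmt7 (ν q SE SV : ℝ) (hν : 0 < ν) (hq : 1 < q) (hSE : 0 < SE) (hSV : 0 < SV)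
    (a C : ℕ → ℝ) (ha : ∀ n : ℕ, 1 ≤ n → |a n| ≤ SE / q ^ n)
    (hC : ∀ n : ℕ, 1 ≤ n → |C n| ≤ SV / q ^ n) (k : ℕ) (hk : 1 ≤ k) :
    Summable (fun i : ℕ =>
        |if 1 ≤ i ∧ i ≠ k then
          (2 * (k : ℝ) * (if i < k then (-1 : ℝ) else 1) * a (((k : ℤ) - (i : ℤ)).natAbs)
              + 2 * (k : ℝ) * a (k + i)) * C i
        else 0|) ∧
    ksDF ν a C k ≤
      (k : ℝ) ^ 2 * (1 - ν * (k : ℝ) ^ 2) * C k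
        + 2 * (k : ℝ) * SE * SV / q ^ (3 * k)
        + 4 * (k : ℝ) * SE * SV / q ^ k * (((k : ℝ) - 1) + (q ^ 2 - 1)⁻¹) := by
  obtain ⟨m, rfl⟩ : ∃ m, k = m + 1 := ⟨k - 1, by omega⟩
  have hq0 : 0 < q := by linarith
  have hq2 : 1 < q ^ 2 := by nlinarith
  set K : ℝ := ((m + 1 : ℕ) : ℝ) with hK
  have hK0 : 0 < K := by rw [hK]; positivity
  set M : ℝ := 2 * K * SE * SV / q ^ (m + 1) with hM
  have hM0 : 0 < M := by positivity
  set f : ℕ → ℝ := fun i : ℕ =>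
        if 1 ≤ i ∧ i ≠ m + 1 then
          (2 * K * (if i < m + 1 then (-1 : ℝ) else 1) * a ((((m + 1 : ℕ) : ℤ) - (i : ℤ)).natAbs)
              + 2 * K * a (m + 1 + i)) * C i
        else 0 with hf
  set r : ℝ := (q ^ 2)⁻¹ with hr
  have hr0 : 0 < r := by positivity
  have hr1 : r < 1 := inv_lt_one_of_one_lt₀ hq2
  set B : ℕ → ℝ := fun i => if i = 0 ∨ i = m + 1 then 0 else
    if i < m + 1 then 2 * M else 2 * M * r ^ (i - (m + 1)) with hB
  have hsum : HasSum B (2 * M * (((m : ℝ)) + (q ^ 2 - 1)⁻¹)) := by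
    rw [← hasSum_nat_add_iff' (m + 2)]
    have h1 : ∑ i ∈ Finset.range (m + 2), B i = 2 * M * m := by
      rw [Finset.sum_range_succ, Finset.sum_range_succ']
      have : ∀ i ∈ Finset.range m, B (i + 1) = 2 * M := by
        intro i hi
        have := Finset.mem_range.1 hi
        simp only [hB]
        rw [if_neg (by omega), if_pos (by omega)]
      rw [Finset.sum_congr rfl this]
      simp [hB]
      ring
    have h2 : (fun n => B (n + (m + 2))) = fun n => 2 * M * r * r ^ n := by
      funext n
      simp only [hB]
      rw [if_neg (by omega), if_neg (by omega),
        show n + (m + 2) - (m + 1) = n + 1 by omega, pow_succ]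
      ring
    rw [h1, h2]
    have h3 := (hasSum_geometric_of_lt_one hr0.le hr1).mul_left (2 * M * r)
    have h4 : q ^ 2 - 1 ≠ 0 := by linarith
    have h5 : r * (1 - r)⁻¹ = (q ^ 2 - 1)⁻¹ := by
      rw [hr, ← mul_inv]
      congr 1
      field_simp
    have h6 : 2 * M * r * (1 - r)⁻¹ = 2 * M * (((m : ℝ)) + (q ^ 2 - 1)⁻¹) - 2 * M * m := by
      rw [mul_assoc, h5]
      ring
    rw [← h6]
    exact h3
  have key : ∀ i p : ℕ, ∀ s : ℝ, |s| = 1 → 1 ≤ i → 1 ≤ p →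
      |(2 * K * s * a p + 2 * K * a (m + 1 + i)) * C i|
        ≤ 2 * K * SE * SV * (1 / q ^ (p + i) + 1 / q ^ (m + 1 + i + i)) := by
    intro i p s hs hi hp
    rw [abs_mul]
    have e1 : |2 * K * s * a p + 2 * K * a (m + 1 + i)|
        ≤ 2 * K * (SE / q ^ p) + 2 * K * (SE / q ^ (m + 1 + i)) := by
      refine (abs_add_le _ _).trans ?_
      rw [abs_mul, abs_mul, abs_mul (2 * K) (a (m + 1 + i)), hs, mul_one,
        abs_of_pos (by positivity : 0 < 2 * K)]
      have := ha p hp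
      have := ha (m + 1 + i) (by omega)
      gcongr
    refine (mul_le_mul e1 (hC i hi) (abs_nonneg _) (by positivity)).trans (le_of_eq ?_)
    rw [pow_add q p i, pow_add q (m + 1 + i) i]
    field_simp
  have hfB : ∀ i, |f i| ≤ B i := by
    intro i
    by_cases hi : 1 ≤ i ∧ i ≠ m + 1
    · simp only [hf, hB]
      rw [if_pos hi, if_neg (show ¬ (i = 0 ∨ i = m + 1) by omega)]
      obtain ⟨hi1, hi2⟩ := hi
      by_cases hlt : i < m + 1
      · rw [if_pos hlt, if_pos hlt]
        refine (key i _ (-1) (by simp) hi1 (by omega)).trans ?_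
        rw [show (((m + 1 : ℕ) : ℤ) - (i : ℤ)).natAbs + i = m + 1 by omega]
        have : 1 / q ^ (m + 1 + i + i) ≤ 1 / q ^ (m + 1) := by
          apply one_div_le_one_div_of_le (by positivity)
          exact pow_le_pow_right₀ hq.le (by omega)
        calc _ ≤ 2 * K * SE * SV * (1 / q ^ (m + 1) + 1 / q ^ (m + 1)) := by gcongr
          _ = _ := by rw [hM]; ring
      · rw [if_neg hlt, if_neg hlt]
        refine (key i _ 1 (by simp) hi1 (by omega)).trans ?_
        obtain ⟨j, rfl⟩ : ∃ j, i = m + 1 + j := ⟨i - (m + 1), by omega⟩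
        rw [show (((m + 1 : ℕ) : ℤ) - ((m + 1 + j : ℕ) : ℤ)).natAbs + (m + 1 + j)
          = m + 1 + 2 * j by omega, show m + 1 + j - (m + 1) = j by omega]
        have : 1 / q ^ (m + 1 + (m + 1 + j) + (m + 1 + j)) ≤ 1 / q ^ (m + 1 + 2 * j) := by
          apply one_div_le_one_div_of_le (by positivity)
          exact pow_le_pow_right₀ hq.le (by omega)
        calc _ ≤ 2 * K * SE * SV * (1 / q ^ (m + 1 + 2 * j) + 1 / q ^ (m + 1 + 2 * j)) := by
              gcongr
          _ = _ := by
              rw [hM, hr, pow_add q (m + 1) (2 * j), pow_mul, inv_pow]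
              field_simp
              ring
    · simp only [hf, hB]
      rw [if_neg hi, if_pos (by omega)]
      simp
  have hs : Summable (fun i => |f i|) :=
    Summable.of_nonneg_of_le (fun i => abs_nonneg _) hfB hsum.summable
  refine ⟨hs, ?_⟩
  have ht : ∑' i, f i ≤ 2 * M * ((m : ℝ) + (q ^ 2 - 1)⁻¹) := by
    rw [← hsum.tsum_eq]
    exact hs.of_abs.tsum_le_tsum (fun i => (le_abs_self _).trans (hfB i)) hsum.summable
  have hd : 2 * K * a (2 * (m + 1)) * C (m + 1) ≤ 2 * K * SE * SV / q ^ (3 * (m + 1)) := by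
    have h1 := ha (2 * (m + 1)) (by omega)
    have h2 := hC (m + 1) (by omega)
    have h3 : a (2 * (m + 1)) * C (m + 1)
        ≤ SE / q ^ (2 * (m + 1)) * (SV / q ^ (m + 1)) := by
      refine (le_abs_self _).trans ?_
      rw [abs_mul]
      exact mul_le_mul h1 h2 (abs_nonneg _) (by positivity)
    calc _ = 2 * K * (a (2 * (m + 1)) * C (m + 1)) := by ring
      _ ≤ 2 * K * (SE / q ^ (2 * (m + 1)) * (SV / q ^ (m + 1))) := by gcongr
      _ = _ := by
        rw [show 3 * (m + 1) = 2 * (m + 1) + (m + 1) by ring, pow_add q (2 * (m + 1)) (m + 1)]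
        field_simp
  have hKm : K - 1 = m := by rw [hK]; push_cast; ring
  have h4 : 4 * K * SE * SV / q ^ (m + 1) = 2 * M := by rw [hM]; ring
  have hdef : ksDF ν a C (m + 1) =
      (K ^ 2 * (1 - ν * K ^ 2) + 2 * K * a (2 * (m + 1))) * C (m + 1) + ∑' i, f i := rfl
  rw [hdef, hKm, h4]
  linarith
end

section
/- Let ν > 0, q > 1, S_E > 0, S_V > 0. Then there exists K ∈ ℕ such that for every k ≥ K, every real sequence a with |a_n| ≤ S_E q^{−n} for all n ≥ 1, and every real sequence C with |C_n| ≤ S_V q^{−n} for all n ≥ 1 and |C_k| = S_V q^{−k}, one has C_k · (D̃F_k(a)C) < 0. (Isolation property of the variational system of the KS equation on the set W_{q,S_E} × W_{q,S_V}.) -/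
theorem ks_hasSum_aux (r : ℝ) (h0 : 0 ≤ r) (h1 : r < 1) (k : ℕ) :
    HasSum (fun i : ℕ => (if i < k then (1 : ℝ) else r ^ (i - k)) + r ^ i)
      ((1 - r)⁻¹ + k + (1 - r)⁻¹) := by
  refine HasSum.add ?_ (hasSum_geometric_of_lt_one h0 h1)
  have h : ∑ i ∈ Finset.range k, (if i < k then (1 : ℝ) else r ^ (i - k)) = k := by
    rw [Finset.sum_congr rfl (g := fun _ => (1 : ℝ))]
    · simp
    · intro i hi
      simp [Finset.mem_range.1 hi]
  rw [← h]
  refine (hasSum_nat_add_iff (f := fun i : ℕ => if i < k then (1 : ℝ) else r ^ (i - k)) k).1 ?_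
  simpa using hasSum_geometric_of_lt_one h0 h1

theorem ks_term_aux (r SE SV : ℝ) (h0 : 0 ≤ r) (h1 : r < 1) (hSE : 0 < SE) (hSV : 0 < SV)
    (k : ℕ) (a C : ℕ → ℝ) (ha : ∀ n : ℕ, 1 ≤ n → |a n| ≤ SE * r ^ n)
    (hC : ∀ n : ℕ, 1 ≤ n → |C n| ≤ SV * r ^ n) (i : ℕ) :
    ‖(if 1 ≤ i ∧ i ≠ k then
          (2 * (k : ℝ) * (if i < k then (-1 : ℝ) else 1) * a (((k : ℤ) - (i : ℤ)).natAbs)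
              + 2 * (k : ℝ) * a (k + i)) * C i
        else 0)‖ ≤ (2 * k * SE * SV * r ^ k) *
          ((if i < k then (1 : ℝ) else r ^ (i - k)) + r ^ i) := by
  split_ifs with hi hik hik
  · set m := ((k : ℤ) - (i : ℤ)).natAbs with hm
    have e : m + i = k := by omega
    have A := ha m (by omega)
    have B := ha (k + i) (by omega)
    have D := hC i hi.1
    have hb : |2 * (k : ℝ) * (-1) * a m + 2 * k * a (k + i)|
        ≤ 2 * k * (SE * r ^ m + SE * r ^ (k + i)) := by
      have : |2 * (k : ℝ) * (-1) * a m + 2 * k * a (k + i)| = 2 * k * |a (k + i) - a m| := by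
        rw [← abs_of_nonneg (show (0 : ℝ) ≤ 2 * k by positivity), ← abs_mul,
          abs_of_nonneg (show (0 : ℝ) ≤ 2 * k by positivity)]
        congr 1; ring
      rw [this]
      gcongr
      exact (abs_sub _ _).trans (by linarith)
    rw [Real.norm_eq_abs, abs_mul]
    refine (mul_le_mul hb D (abs_nonneg _) (by positivity)).trans ?_
    have h2 : r ^ i ≤ 1 := pow_le_one₀ h0 h1.le
    have h3 : r ^ i * r ^ i ≤ r ^ i := mul_le_of_le_one_left (by positivity) h2
    have e1 : 2 * (k : ℝ) * (SE * r ^ m + SE * r ^ (k + i)) * (SV * r ^ i)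
      = (2 * k * SE * SV) * (r ^ (m + i) + r ^ k * (r ^ i * r ^ i)) := by ring
    rw [e1, e, mul_assoc (2 * (k : ℝ) * SE * SV), mul_add (r ^ k), mul_one]
    gcongr
  · set m := ((k : ℤ) - (i : ℤ)).natAbs with hm
    have e : m = i - k := by omega
    have e' : i = m + k := by omega
    have A := ha m (by omega)
    have B := ha (k + i) (by omega)
    have D := hC i hi.1
    have hb : |2 * (k : ℝ) * 1 * a m + 2 * k * a (k + i)|
        ≤ 2 * k * (SE * r ^ m + SE * r ^ (k + i)) := by
      have : |2 * (k : ℝ) * 1 * a m + 2 * k * a (k + i)| = 2 * k * |a m + a (k + i)| := by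
        rw [← abs_of_nonneg (show (0 : ℝ) ≤ 2 * k by positivity), ← abs_mul,
          abs_of_nonneg (show (0 : ℝ) ≤ 2 * k by positivity)]
        congr 1; ring
      rw [this]
      gcongr
      exact (abs_add_le _ _).trans (by linarith)
    rw [Real.norm_eq_abs, abs_mul]
    refine (mul_le_mul hb D (abs_nonneg _) (by positivity)).trans ?_
    have h2 : r ^ i ≤ 1 := pow_le_one₀ h0 h1.le
    have h3 : r ^ i * r ^ i ≤ r ^ i := mul_le_of_le_one_left (by positivity) h2
    have h4 : r ^ i ≤ r ^ k := pow_le_pow_of_le_one h0 h1.le (by omega)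
    have h5 : r ^ m * r ^ i ≤ r ^ k * r ^ m := by
      rw [mul_comm]; gcongr
    have e1 : 2 * (k : ℝ) * (SE * r ^ m + SE * r ^ (k + i)) * (SV * r ^ i)
      = (2 * k * SE * SV) * (r ^ m * r ^ i + r ^ k * (r ^ i * r ^ i)) := by ring
    rw [e1, ← e, mul_assoc (2 * (k : ℝ) * SE * SV), mul_add (r ^ k)]
    gcongr
  · rw [norm_zero]; positivity
  · rw [norm_zero]; positivity

/-- Let `ν > 0`, `q > 1`, `S_E > 0`, `S_V > 0`.  Then there exists `K ∈ ℕ` such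
that for every `k ≥ K`, every sequence `a` with `|a_n| ≤ S_E q^{-n}` for all `n ≥ 1`, and every
sequence `C` with `|C_n| ≤ S_V q^{-n}` for all `n ≥ 1` and `|C_k| = S_V q^{-k}`, one has
`C_k · (D̃F_k(a)C) < 0` (isolation property of the variational system of the KS equation on
`W_{q,S_E} × W_{q,S_V}`). -/
theorem stmt8 (ν q SE SV : ℝ) (hν : 0 < ν) (hq : 1 < q) (hSE : 0 < SE) (hSV : 0 < SV) :
    ∃ K : ℕ, ∀ k : ℕ, K ≤ k → ∀ a C : ℕ → ℝ,
      (∀ n : ℕ, 1 ≤ n → |a n| ≤ SE / q ^ n) →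
      (∀ n : ℕ, 1 ≤ n → |C n| ≤ SV / q ^ n) → |C k| = SV / q ^ k →
        C k * ksDF ν a C k < 0 := by
  set r := q⁻¹ with hr
  have h0 : 0 < r := by positivity
  have h1 : r < 1 := inv_lt_one_of_one_lt₀ hq
  have hd : ∀ (S : ℝ) (n : ℕ), S / q ^ n = S * r ^ n := by
    intro S n; rw [hr, inv_pow, div_eq_mul_inv]
  simp only [hd]
  set M := (1 - r)⁻¹ with hM
  have hM0 : 0 < M := inv_pos.2 (by linarith)
  obtain ⟨N, hN⟩ := exists_nat_gt ((1 + 4 * SE + 4 * SE * M) / ν)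
  refine ⟨N + 1, fun k hk a C ha hC hCk => ?_⟩
  have hk1 : (1 : ℝ) ≤ k := by exact_mod_cast (by omega : 1 ≤ k)
  have hkN : (N : ℝ) ≤ k := by exact_mod_cast (by omega : N ≤ k)
  have hB : 1 + 4 * SE + 4 * SE * M < ν * (k : ℝ) ^ 2 := by
    rw [div_lt_iff₀ hν] at hN
    nlinarith [mul_le_mul_of_nonneg_left hkN hν.le, mul_le_mul_of_nonneg_left hk1 (by positivity : 0 ≤ ν * (k : ℝ))]
  have hT := tsum_of_norm_bounded ((ks_hasSum_aux r h0.le h1 k).mul_left (2 * k * SE * SV * r ^ k))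
    (ks_term_aux r SE SV h0.le h1 hSE hSV k a C ha hC)
  unfold ksDF
  generalize (∑' i : ℕ, (if 1 ≤ i ∧ i ≠ k then
          (2 * (k : ℝ) * (if i < k then (-1 : ℝ) else 1) * a (((k : ℤ) - (i : ℤ)).natAbs)
              + 2 * (k : ℝ) * a (k + i)) * C i
        else 0)) = T at hT ⊢
  rw [Real.norm_eq_abs, ← hM] at hT
  have ha2 : a (2 * k) ≤ SE := by
    refine (le_abs_self _).trans ((ha (2 * k) (by omega)).trans ?_)
    exact mul_le_of_le_one_right hSE.le (pow_le_one₀ h0.le h1.le)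
  set x := SV * r ^ k with hx
  have hx0 : 0 < x := by positivity
  have hsq : C k * C k = x ^ 2 := by rw [← abs_mul_abs_self, hCk]; ring
  have hCT : C k * T ≤ x * ((2 * k * SE * SV * r ^ k) * (M + k + M)) := by
    refine (le_abs_self _).trans ?_
    rw [abs_mul, hCk]
    gcongr
  have e1 : x * ((2 * k * SE * SV * r ^ k) * (M + k + M)) = x ^ 2 * (2 * k * SE * (M + k + M)) := by
    rw [hx]; ring
  have e2 : C k * (((k : ℝ) ^ 2 * (1 - ν * (k : ℝ) ^ 2) + 2 * (k : ℝ) * a (2 * k)) * C k + T)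
      = x ^ 2 * ((k : ℝ) ^ 2 * (1 - ν * (k : ℝ) ^ 2) + 2 * (k : ℝ) * a (2 * k)) + C k * T := by
    rw [← hsq]; ring
  rw [e2]
  rw [e1] at hCT
  have hneg : ((k : ℝ) ^ 2 * (1 - ν * (k : ℝ) ^ 2) + 2 * (k : ℝ) * a (2 * k))
      + 2 * k * SE * (M + k + M) < 0 := by
    have p1 : 2 * (k : ℝ) * a (2 * k) ≤ 2 * k * SE := by gcongr
    have p2 : (k : ℝ) ≤ (k : ℝ) ^ 2 := by nlinarith
    have p3 : (k : ℝ) * SE ≤ (k : ℝ) ^ 2 * SE := by gcongr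
    have p4 : (k : ℝ) * (SE * M) ≤ (k : ℝ) ^ 2 * (SE * M) := by gcongr
    have p5 := mul_lt_mul_of_pos_left hB (by positivity : 0 < (k : ℝ) ^ 2)
    nlinarith
  have := mul_neg_of_pos_of_neg (pow_pos hx0 2) hneg
  linarith
end
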